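/- For every δ ∈ (0, 1/100) there exists a constant C = C(δ) > 0 such that the following holds for every integer n ≥ 1. For all vertices x, y ∈ ∂B_n and any arc J_{x,y} of the closed polygonal curve ∂B_n with endpoints x and y (either of the two arcs) such that the Euclidean diameter of ∂B_n ∖ J_{x,y} is at least 10δn, the Green's function of the simple random walk killed upon exiting the δn-sausage of J_{x,y} satisfies G_{J_{x,y}^{δn}}(x,y) ≥ C, where J_{x,y}^{δn} := {z ∈ ℝ² : dist(z, J_{x,y}) ≤ δn}. -/

import Mathlib

open MeasureTheory Set
open scoped ENNReal NNReal

noncomputable section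

namespace RWLSPaper

open scoped Classical

/-- Vertices of the square lattice `ℤ²`. -/
abbrev Lat : Type := ℤ × ℤ

/-- The plane `ℝ²`, with the Euclidean metric. -/
abbrev Plane : Type := EuclideanSpace ℝ (Fin 2)

/-- Embedding of the lattice into the plane. -/
def emb (z : Lat) : Plane := (WithLp.equiv 2 (Fin 2 → ℝ)).symm ![(z.1 : ℝ), (z.2 : ℝ)]

/-- Lattice adjacency: Euclidean distance one. -/
def Adj (a b : Lat) : Prop := (a.1 - b.1) ^ 2 + (a.2 - b.2) ^ 2 = 1

/-- ℓ∞ norm on the lattice. -/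
def linf (a : Lat) : ℤ := max |a.1| |a.2|

/-- The box `B_R(z) = {w : |w - z|_∞ ≤ R}`. -/
def box (z : Lat) (R : ℤ) : Set Lat := {w | linf (w - z) ≤ R}

/-- Inner vertex boundary of a set of vertices. -/
def bdry (A : Set Lat) : Set Lat := {z | z ∈ A ∧ ∃ w, w ∉ A ∧ linf (z - w) = 1}

/-- A set of vertices, embedded in the plane. -/
def embS (A : Set Lat) : Set Plane := emb '' A

/-- The boundary of the box `B_R(z)`, embedded in the plane. -/
def bdryE (z : Lat) (R : ℤ) : Set Plane := embS (bdry (box z R))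

/-- The solid box `z + [-R,R]²` in the plane. -/
def boxP (z : Lat) (R : ℤ) : Set Plane :=
  {p | |p 0 - (z.1 : ℝ)| ≤ (R : ℝ) ∧ |p 1 - (z.2 : ℝ)| ≤ (R : ℝ)}

/-- Trace of a list of vertices: the vertices, together with the segments joining
consecutive ones. -/
def traceL (l : List Lat) : Set Plane :=
  (⋃ z ∈ l, {emb z}) ∪ ⋃ p ∈ l.zip l.tail, segment ℝ (emb p.1) (emb p.2)

/-- Nearest-neighbour paths: nonempty lists of successively adjacent vertices. -/
def IsPath (l : List Lat) : Prop := l ≠ [] ∧ l.Chain' Adj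

/-- Number of steps of a path. -/
def steps (l : List Lat) : ℕ := l.length - 1

/-- Paths from `z` to `w` with at least one step. -/
def PathsBetween (z w : Lat) : Set (List Lat) :=
  {l | IsPath l ∧ l.head? = some z ∧ l.getLast? = some w ∧ 2 ≤ l.length}

/-- Total mass of a set of paths under the measure giving weight `4^{-|η|}` to each
path `η`. -/
def pathMass (M : Set (List Lat)) : ℝ≥0∞ :=
  ∑' l : M, (4 : ℝ≥0∞)⁻¹ ^ steps l.1

/-- `A` disconnects `B` from `C` in the plane: every continuous path joining a point
of `B` to a point of `C` meets `A`. -/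
def Disconnects (A B C : Set Plane) : Prop :=
  ∀ γ : ℝ → Plane, ContinuousOn γ (Icc 0 1) → γ 0 ∈ B → γ 1 ∈ C →
    ∃ t ∈ Icc (0 : ℝ) 1, γ t ∈ A

/-- The set `M^{z,w}_{r,R}` of paths from `z` to `w` which intersect `∂B_R` and do
not disconnect `B_r` from `∂B_R`. -/
def MSet (z w : Lat) (r R : ℤ) : Set (List Lat) :=
  {l | l ∈ PathsBetween z w ∧ (traceL l ∩ bdryE 0 R).Nonempty ∧
    ¬ Disconnects (traceL l) (embS (box 0 r)) (bdryE 0 R)}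

/-- Nearest-neighbour walks from `u` to `v` staying in `D`. -/
def WalksIn (D : Set Lat) (u v : Lat) : Set (List Lat) :=
  {l | IsPath l ∧ l.head? = some u ∧ l.getLast? = some v ∧ ∀ x ∈ l, x ∈ D}

/-- The Green's function of simple random walk killed upon exiting `D`, through the
path-sum formula `G_D(u,v) = Σ_{η : u → v, η ⊆ D} 4^{-|η|}`. -/
def green (D : Set Lat) (u v : Lat) : ℝ≥0∞ :=
  ∑' l : WalksIn D u v, (4 : ℝ≥0∞)⁻¹ ^ steps l.1

/-! ### Loops -/

/-- A rooted loop, encoded by its cyclic word: a nonempty list of vertices which,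
cyclically, are successively adjacent. -/
structure RootedLoop where
  word : List Lat
  ne : word ≠ []
  adj : (word ++ word.take 1).Chain' Adj

/-- Rerooting (cyclic relabeling) relation on rooted loops. -/
def loopRot (l l' : RootedLoop) : Prop := ∃ k, l'.word = l.word.rotate k

/-- Unrooted loops: rooted loops modulo rerooting. -/
def ULoop : Type := Quot loopRot

/-- A representative of an unrooted loop. -/
def ULoop.out (γ : ULoop) : RootedLoop := Quot.out γ

/-- Number of steps of a loop. -/
def ULoop.steps (γ : ULoop) : ℕ := γ.out.word.length

/-- Vertices visited by a loop. -/
def ULoop.verts (γ : ULoop) : Set Lat := {x | x ∈ γ.out.word}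

/-- The trace of a loop in the plane. -/
def ULoop.trace (γ : ULoop) : Set Plane := traceL (γ.out.word ++ γ.out.word.take 1)

/-- The multiplicity `J(γ)`: the largest `j` such that `γ` is the concatenation of
`j` copies of a single loop. -/
def ULoop.mult (γ : ULoop) : ℕ :=
  sSup {j : ℕ | ∃ u : List Lat, u ≠ [] ∧ γ.out.word = (List.replicate j u).flatten}

/-- The unrooted loop measure: `ν(γ) = 4^{-|γ|} / J(γ)`. -/
def loopWeight (γ : ULoop) : ℝ≥0 := (4 : ℝ≥0)⁻¹ ^ γ.steps / (γ.mult : ℝ≥0)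

/-- Total `ν`-mass of a set of loops. -/
def nuMass (S : Set ULoop) : ℝ≥0∞ := ∑' γ : S, (loopWeight γ.1 : ℝ≥0∞)

/-- `ν(γ)` if `γ` is contained in `D`, and `0` otherwise. -/
def nuD (D : Set Lat) (γ : ULoop) : ℝ≥0 := if ULoop.verts γ ⊆ D then loopWeight γ else 0

/-! ### The random walk loop soup -/

/-- Loop configurations: multiplicity functions on unrooted loops. -/
abbrev Config : Type := ULoop → ℕ

/-- The set of loops appearing in a configuration. -/
def Config.loops (ω : Config) : Set ULoop := {γ | ω γ ≠ 0}

/-- The Poisson probability mass function with mean `r`. -/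
def poissonProb (r : ℝ≥0) (k : ℕ) : ℝ≥0∞ :=
  ENNReal.ofReal (Real.exp (-(r : ℝ)) * (r : ℝ) ^ k / k.factorial)

/-- `P` is the law of the random walk loop soup in `D` with intensity `α`: a Poisson
point process with intensity `α·ν` restricted to loops contained in `D`; equivalently,
the multiplicities of the various loops are independent, the multiplicity of a loop
`γ ⊆ D` being Poisson-distributed with mean `α ν(γ)`. -/
def IsLoopSoup (D : Set Lat) (α : ℝ) (P : Measure Config) : Prop :=
  IsProbabilityMeasure P ∧
  ∀ (s : Finset ULoop) (m : ULoop → ℕ),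
    P {ω | ∀ γ ∈ s, ω γ = m γ} = ∏ γ ∈ s, poissonProb (α.toNNReal * nuD D γ) (m γ)

/-- Decreasing events of the loop soup. -/
def DecreasingEvent (E : Set Config) : Prop :=
  ∀ ω ω' : Config, (∀ γ, ω' γ ≤ ω γ) → ω ∈ E → ω' ∈ E

/-! ### Clusters -/

/-- Two loops are adjacent when they intersect. -/
def Touches (γ γ' : ULoop) : Prop := (ULoop.verts γ ∩ ULoop.verts γ').Nonempty

/-- Connection of loops within a family `L` of loops: transitive closure of adjacency. -/
def linkedL (L : Set ULoop) : ULoop → ULoop → Prop :=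
  Relation.ReflTransGen (fun a b => a ∈ L ∧ b ∈ L ∧ Touches a b)

/-- The cluster of `γ` in `L`, as a set of loops. -/
def clusterClass (L : Set ULoop) (γ : ULoop) : Set ULoop := {γ' | γ' ∈ L ∧ linkedL L γ γ'}

/-- The subset of the plane covered by a family of loops. -/
def classTrace (K : Set ULoop) : Set Plane := ⋃ γ ∈ K, ULoop.trace γ

/-- The clusters of a loop configuration, regarded as subsets of the plane. -/
def clusters (L : Set ULoop) : Set (Set Plane) :=
  {C | ∃ γ ∈ L, C = classTrace (clusterClass L γ)}

/-- `Λ(A, L)`: the union of `A` with all the clusters of `L` meeting `A`. -/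
def LamL (A : Set Plane) (L : Set ULoop) : Set Plane :=
  A ∪ ⋃ C ∈ {C | C ∈ clusters L ∧ (C ∩ A).Nonempty}, C

/-- Connection within an arbitrary family of subsets of the plane (two members being
adjacent when they intersect). -/
def linkedS (F : Set (Set Plane)) : Set Plane → Set Plane → Prop :=
  Relation.ReflTransGen (fun a b => a ∈ F ∧ b ∈ F ∧ (a ∩ b).Nonempty)

/-- Clusters of a family of subsets of the plane. -/
def clustersS (F : Set (Set Plane)) : Set (Set Plane) :=
  {C | ∃ S ∈ F, C = ⋃ S' ∈ {S' | S' ∈ F ∧ linkedS F S S'}, S'}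

/-- `Λ(A, F)` for a family `F` of subsets of the plane. -/
def LamS (A : Set Plane) (F : Set (Set Plane)) : Set Plane :=
  A ∪ ⋃ C ∈ {C | C ∈ clustersS F ∧ (C ∩ A).Nonempty}, C

/-- The traces of a family of loops. -/
def traces (L : Set ULoop) : Set (Set Plane) := ULoop.trace '' L

/-! ### Filling, frontier, outermost clusters, crossings -/

/-- The filling of a set: the complement of the union of all unbounded connected
subsets of the complement of its closure. -/
def Fill (A : Set Plane) : Set Plane :=
  {x | ∀ C : Set Plane, C ⊆ (closure A)ᶜ → IsConnected C → x ∈ C → Bornology.IsBounded C}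

/-- The frontier of a loop: the topological boundary of the filling of its trace. -/
def loopFrontier (γ : ULoop) : Set Plane := frontier (Fill (ULoop.trace γ))

/-- The frontiers of the loops of a family. -/
def frontiers (L : Set ULoop) : Set (Set Plane) := loopFrontier '' L

/-- An outermost cluster of `L`. -/
def Outermost (L : Set ULoop) (C : Set Plane) : Prop :=
  C ∈ clusters L ∧ ∀ C' ∈ clusters L, C' ≠ C → ¬ Fill C ⊆ Fill C'

/-- `S` crosses the annulus `A_{r,R}(z)`: it meets both `∂B_r(z)` and `∂B_R(z)`. -/
def CrossesAnn (S : Set Plane) (z : Lat) (r R : ℤ) : Prop :=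
  (S ∩ bdryE z r).Nonempty ∧ (S ∩ bdryE z R).Nonempty

/-! ### Arm events -/

/-- The four-arm event: at least two distinct outermost clusters cross `A_{l,d}(z)`. -/
def fourArm (z : Lat) (l d : ℤ) (L : Set ULoop) : Prop :=
  ∃ C1 C2 : Set Plane, Outermost L C1 ∧ Outermost L C2 ∧ C1 ≠ C2 ∧
    CrossesAnn C1 z l d ∧ CrossesAnn C2 z l d

/-- The four-arm event, as a set of configurations. -/
def A4 (z : Lat) (l d : ℤ) : Set Config := {ω | fourArm z l d ω.loops}

/-- The truncated four-arm event `→𝒜(z;l,d)`. -/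
def A4trunc (z : Lat) (l d : ℤ) : Set Config :=
  {ω | fourArm z l d ω.loops ∧ LamL (embS (box z l)) ω.loops ⊆ boxP z (2 * d)}

/-- The truncated inward four-arm event `←𝒜(z;l,d)`. -/
def A4in (z : Lat) (l d : ℤ) : Set Config :=
  {ω | fourArm z l d ω.loops ∧
    LamL (embS (bdry (box z d))) ω.loops ∩ embS (box z (l / 2)) = ∅}

/-- Lattice points in the open upper half-plane `ℍ`. -/
def upperLat : Set Lat := {w | 0 < w.2}

/-- The upper part of the boundary of `B_R`, embedded in the plane. -/
def bdryEP (R : ℤ) : Set Plane := embS (bdry (box 0 R) ∩ upperLat)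

/-- `S` crosses the half-annulus `A^+_{r,R}`. -/
def CrossesAnnP (S : Set Plane) (r R : ℤ) : Prop :=
  (S ∩ bdryEP r).Nonempty ∧ (S ∩ bdryEP R).Nonempty

/-- The interior two-arm event: some outermost cluster has a frontier crossing `A_{l,d}`. -/
def A2 (l d : ℤ) : Set Config :=
  {ω | ∃ C, Outermost ω.loops C ∧ CrossesAnn (frontier (Fill C)) 0 l d}

/-- The boundary two-arm event. -/
def A2P (l d : ℤ) : Set Config :=
  {ω | ∃ C, Outermost ω.loops C ∧ CrossesAnnP (frontier (Fill C)) l d}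

/-- The boundary four-arm event. -/
def A4P (l d : ℤ) : Set Config :=
  {ω | ∃ C1 C2, Outermost ω.loops C1 ∧ Outermost ω.loops C2 ∧ C1 ≠ C2 ∧
    CrossesAnnP C1 l d ∧ CrossesAnnP C2 l d}

/-- Outward truncation condition: `Λ(B_l, ·) ⊆ B_{2d}`. -/
def TruncOut (l d : ℤ) (ω : Config) : Prop :=
  LamL (embS (box 0 l)) ω.loops ⊆ boxP 0 (2 * d)

/-- Inward truncation condition: `Λ(∂B_d, ·) ∩ B_{⌊l/2⌋} = ∅`. -/
def TruncIn (l d : ℤ) (ω : Config) : Prop :=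
  LamL (embS (bdry (box 0 d))) ω.loops ∩ embS (box 0 (l / 2)) = ∅

/-! ### Random walks and qualities -/

/-- `μ` is the law of the simple random walk on `ℤ²` started at `z`, as a measure on
`ℕ → ℤ²`. -/
def IsSRW (z : Lat) (μ : Measure (ℕ → Lat)) : Prop :=
  IsProbabilityMeasure μ ∧
  ∀ (n : ℕ) (f : ℕ → Lat), f 0 = z → (∀ i < n, Adj (f i) (f (i + 1))) →
    μ {w | ∀ i ≤ n, w i = f i} = (4 : ℝ≥0∞)⁻¹ ^ n

/-- First hitting time of a set of vertices by a walk. -/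
def hitTime (w : ℕ → Lat) (A : Set Lat) : ℕ := sInf {i | w i ∈ A}

/-- Position of a walk at its first hitting of `A`. -/
def hitPt (w : ℕ → Lat) (A : Set Lat) : Lat := w (hitTime w A)

/-- Trace of a walk, stopped at its first hitting of `A`. -/
def stoppedTrace (w : ℕ → Lat) (A : Set Lat) : Set Plane :=
  traceL ((List.range (hitTime w A + 1)).map w)

/-- The walk stays in `D` up to its first hitting of `A`. -/
def StaysIn (w : ℕ → Lat) (D A : Set Lat) : Prop := ∀ i ≤ hitTime w A, w i ∈ D

/-- `μ` is the law of the simple random walk started at `z`, conditioned to stay in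
`D` until it first hits `A`. -/
def IsCondSRW (z : Lat) (D A : Set Lat) (μ : Measure (ℕ → Lat)) : Prop :=
  ∃ ν : Measure (ℕ → Lat), IsSRW z ν ∧
    μ = (ν {w | StaysIn w D A})⁻¹ • ν.restrict {w | StaysIn w D A}

/-- Lattice ball of real radius (ℓ∞ distance). -/
def ballV (c : Lat) (ρ : ℝ) : Set Lat := {w | ((linf (w - c) : ℤ) : ℝ) ≤ ρ}

/-- Union of the stopped traces of a packet of walks. -/
def packTrace {j : ℕ} (ws : Fin j → ℕ → Lat) (A : Set Lat) : Set Plane :=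
  ⋃ i, stoppedTrace (ws i) A

/-- Union of the balls of radius `ρ` around the hitting points of a packet of walks. -/
def packBalls {j : ℕ} (ws : Fin j → ℕ → Lat) (A : Set Lat) (ρ : ℝ) : Set Plane :=
  ⋃ i, embS (ballV (hitPt (ws i) A) ρ)

/-- The frontiers of the loops of `ω` not contained in `B_r`. -/
def outerFrontiers (r : ℤ) (ω : Config) : Set (Set Plane) :=
  frontiers {γ | γ ∈ ω.loops ∧ ¬ ULoop.verts γ ⊆ box 0 r}

/-- The frontiers of the loops of `ω` meeting `B_R`. -/
def meetFrontiers (R : ℤ) (ω : Config) : Set (Set Plane) :=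
  frontiers {γ | γ ∈ ω.loops ∧ (ULoop.verts γ ∩ box 0 R).Nonempty}

/-- Quality at scale `s` for two packets of walks inside a loop soup, with initial
configuration `(Lr, V1, V2)` at scale `r`. -/
def qualityJK (Lr : Set ULoop) (V1 V2 : Set Lat) (r : ℤ) {j k : ℕ}
    (w1 : Fin j → ℕ → Lat) (w2 : Fin k → ℕ → Lat) (ω : Config) (s : ℤ) : ℝ :=
  sSup {δ : ℝ | 0 ≤ δ ∧
    LamS (embS V1 ∪ packTrace w1 (bdry (box 0 s)) ∪ packBalls w1 (bdry (box 0 s)) (δ * (s : ℝ)))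
        (traces Lr ∪ outerFrontiers r ω) ∩
      (embS V2 ∪ packTrace w2 (bdry (box 0 s)) ∪
        packBalls w2 (bdry (box 0 s)) (δ * (s : ℝ))) = ∅}

/-- Quality at scale `s` for a single pair of walks. -/
def qualityPair (Lr : Set ULoop) (V1 V2 : Set Lat) (r : ℤ)
    (w1 w2 : ℕ → Lat) (ω : Config) (s : ℤ) : ℝ :=
  qualityJK Lr V1 V2 r (fun _ : Fin 1 => w1) (fun _ : Fin 1 => w2) ω s

/-- Reversed quality at scale `s`, for two packets walking inward from `∂B_R`. -/
def qualityRev (L : Set ULoop) (V1 V2 : Set Lat) (R : ℤ) {j k : ℕ}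
    (w1 : Fin j → ℕ → Lat) (w2 : Fin k → ℕ → Lat) (ω : Config) (s : ℤ) : ℝ :=
  sSup {δ : ℝ | 0 ≤ δ ∧
    LamS (embS V1 ∪ packTrace w1 (bdry (box 0 s)) ∪ packBalls w1 (bdry (box 0 s)) (δ * (s : ℝ)))
        (traces L ∪ meetFrontiers R ω) ∩
      (embS V2 ∪ packTrace w2 (bdry (box 0 s)) ∪
        packBalls w2 (bdry (box 0 s)) (δ * (s : ℝ))) = ∅}

/-- Quality at scale `s` for one packet of walks, with non-disconnection of `U`. -/
def qualityDisc (Lr : Set ULoop) (U : Set Lat) (r : ℤ) {j : ℕ}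
    (ws : Fin j → ℕ → Lat) (ω : Config) (s : ℤ) : ℝ :=
  sSup {δ : ℝ | 0 ≤ δ ∧
    embS U ∩ Fill (LamS
      (packTrace ws (bdry (box 0 s)) ∪ packBalls ws (bdry (box 0 s)) (δ * (s : ℝ)))
      (traces Lr ∪ outerFrontiers r ω)) = ∅}

/-! ### Crossing loops and bad clusters -/

/-- Crossing loops: loops contained in `D` which cross `A_{d,k}` without
disconnecting `B_d` from `∂B_k`. -/
def crossingLoops (D : Set Lat) (d k : ℤ) : Set ULoop :=
  {γ | ULoop.verts γ ⊆ D ∧ CrossesAnn (ULoop.trace γ) 0 d k ∧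
    ¬ Disconnects (ULoop.trace γ) (embS (box 0 d)) (bdryE 0 k)}

/-- `K` is a bad cluster of `L` for the annulus `A_{l,d}`, relative to the set `CL` of
crossing loops: an outermost cluster crossing `A_{l,d}` which no longer crosses it
once its crossing loops are removed. -/
def IsBad (CL : Set ULoop) (l d : ℤ) (L : Set ULoop) (K : Set ULoop) : Prop :=
  (∃ γ ∈ L, K = clusterClass L γ) ∧
  Outermost L (classTrace K) ∧ CrossesAnn (classTrace K) 0 l d ∧
  ¬ CrossesAnn (classTrace (K \ CL)) 0 l d

/-- `E_1`: the four-arm event holds, with exactly one bad cluster. -/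
def E1 (CL : Set ULoop) (l d : ℤ) : Set Config :=
  {ω | fourArm 0 l d ω.loops ∧ ∃! K : Set ULoop, IsBad CL l d ω.loops K}

/-- `E_2`: the four-arm event holds, with at least two bad clusters. -/
def E2 (CL : Set ULoop) (l d : ℤ) : Set Config :=
  {ω | fourArm 0 l d ω.loops ∧
    ∃ K K' : Set ULoop, K ≠ K' ∧ IsBad CL l d ω.loops K ∧ IsBad CL l d ω.loops K'}

/-- Number of crossing loops of a configuration, counted with multiplicity. -/
def crossingCount (CL : Set ULoop) (ω : Config) : ℝ≥0∞ := ∑' γ : CL, (ω γ.1 : ℝ≥0∞)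

/-! ### Arcs of the square -/

/-- The square curve `{‖p‖_∞ = n}`: the closed polygonal curve through `∂B_n`. -/
def sqCurve (n : ℤ) : Set Plane := {p | max |p 0| |p 1| = (n : ℝ)}

/-- `J` is one of the two arcs of the closed curve `∂B_n` with endpoints `x` and `y`. -/
def IsArc (n : ℤ) (x y : Lat) (J : Set Plane) : Prop :=
  IsClosed J ∧ IsConnected J ∧ J ⊆ sqCurve n ∧ emb x ∈ J ∧ emb y ∈ J ∧
  IsConnected ((sqCurve n \ J) ∪ {emb x, emb y})

/-- The four lattice neighbours of a vertex. -/
def nb (i : Fin 4) (z : Lat) : Lat :=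
  ![(z.1 + 1, z.2), (z.1 - 1, z.2), (z.1, z.2 + 1), (z.1, z.2 - 1)] i

theorem adj_nb (i : Fin 4) (z : Lat) : Adj z (nb i z) := by
  fin_cases i <;> simp [nb, Adj]

theorem nb_inj (z : Lat) {i j : Fin 4} (h : nb i z = nb j z) : i = j := by
  fin_cases i <;> fin_cases j <;> simp [nb, Prod.ext_iff] at h ⊢ <;> omega

theorem exists_nb_of_adj {a b : Lat} (h : Adj a b) : ∃ i, b = nb i a := by
  unfold Adj at h
  obtain ⟨a1, a2⟩ := a
  obtain ⟨b1, b2⟩ := b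
  simp only at h
  have h1 : (a1 - b1) ≤ 1 := by nlinarith [sq_nonneg (a2 - b2)]
  have h2 : -1 ≤ (a1 - b1) := by nlinarith [sq_nonneg (a2 - b2)]
  have h3 : (a2 - b2) ≤ 1 := by nlinarith [sq_nonneg (a1 - b1)]
  have h4 : -1 ≤ (a2 - b2) := by nlinarith [sq_nonneg (a1 - b1)]
  obtain ⟨u, hu⟩ : ∃ u, u = a1 - b1 := ⟨_, rfl⟩
  obtain ⟨v, hv⟩ : ∃ v, v = a2 - b2 := ⟨_, rfl⟩
  rw [← hu] at h h1 h2
  rw [← hv] at h h3 h4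
  have hb1 : b1 = a1 - u := by omega
  have hb2 : b2 = a2 - v := by omega
  subst hb1 hb2
  interval_cases u <;> interval_cases v <;> simp at h
  · exact ⟨0, by simp [nb]⟩
  · exact ⟨2, by simp [nb]⟩
  · exact ⟨3, by simp [nb]⟩
  · exact ⟨1, by simp [nb]⟩

/-- Prepending a vertex to a walk. -/
theorem cons_mem_walks {D : Set Lat} {x y : Lat} (hx : x ∈ D) (i : Fin 4)
    {l : List Lat} (hl : l ∈ WalksIn D (nb i x) y) : x :: l ∈ WalksIn D x y := by
  obtain ⟨⟨hne, hch⟩, hh, hlast, hin⟩ := hl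
  cases l with
  | nil => exact absurd rfl hne
  | cons a t =>
    simp only [List.head?_cons, Option.some.injEq] at hh
    subst hh
    refine ⟨⟨by simp, ?_⟩, by simp, ?_, ?_⟩
    · exact List.isChain_cons_cons.2 ⟨adj_nb i x, hch⟩
    · rw [List.getLast?_cons_cons]; exact hlast
    · intro z hz
      rcases List.mem_cons.1 hz with rfl | hz
      · exact hx
      · exact hin z hz

theorem green_super (D : Set Lat) (x y : Lat) (hx : x ∈ D) :
    (4 : ℝ≥0∞)⁻¹ * ∑ i, green D (nb i x) y + (if x = y then 1 else 0) ≤ green D x y := by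
  set f : ((Σ i : Fin 4, WalksIn D (nb i x) y) ⊕ {_u : Unit // x = y}) → WalksIn D x y :=
    Sum.elim (fun p => ⟨x :: p.2.1, cons_mem_walks hx p.1 p.2.2⟩)
      (fun u => ⟨[x], ⟨⟨by simp, by exact List.isChain_singleton _⟩, by simp, by simpa using u.2,
        by simpa using hx⟩⟩) with hf
  have hinj : Function.Injective f := by
    rintro (⟨i, l, hl⟩ | ⟨u, hu⟩) (⟨j, l', hl'⟩ | ⟨u', hu'⟩) h
    · simp only [hf, Sum.elim_inl, Subtype.mk.injEq, List.cons.injEq, true_and] at h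
      subst h
      have : nb i x = nb j x := by
        have h1 := hl.2.1
        have h2 := hl'.2.1
        rw [h1] at h2
        exact Option.some.inj h2
      obtain rfl := nb_inj x this
      rfl
    · simp only [hf, Sum.elim_inl, Sum.elim_inr] at h
      exact absurd (by simpa using congrArg Subtype.val h) hl.1.1
    · simp only [hf, Sum.elim_inl, Sum.elim_inr] at h
      exact absurd (by simpa using (congrArg Subtype.val h).symm) hl'.1.1
    · rfl
  have key := ENNReal.tsum_comp_le_tsum_of_injective hinj
    (fun l : WalksIn D x y => (4 : ℝ≥0∞)⁻¹ ^ steps l.1)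
  refine le_trans (le_of_eq ?_) key
  rw [Summable.tsum_sum (f := fun a => (4 : ℝ≥0∞)⁻¹ ^ steps (f a).1) ENNReal.summable ENNReal.summable]
  congr 1
  · rw [ENNReal.tsum_sigma', tsum_fintype, Finset.mul_sum]
    refine Finset.sum_congr rfl fun i _ => ?_
    rw [green, ← ENNReal.tsum_mul_left]
    refine tsum_congr fun l => ?_
    have : l.1 ≠ [] := l.2.1.1
    have hlen : l.1.length - 1 + 1 = l.1.length := by
      have := List.length_pos_iff.2 this
      omega
    simp only [hf, Sum.elim_inl, steps, List.length_cons, Nat.add_sub_cancel]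
    conv_rhs => rw [← hlen]
    rw [pow_succ, mul_comm]
  · by_cases hxy : x = y
    · have : Unique {_u : Unit // x = y} := ⟨⟨⟨(), hxy⟩⟩, fun a => by ext⟩
      rw [tsum_fintype]
      simp [hxy, hf, steps]
    · have : IsEmpty {_u : Unit // x = y} := ⟨fun a => hxy a.2⟩
      simp [hxy]

/-- Comparison (maximum) principle. -/
theorem comparison (B : Set Lat) (hB : B.Finite) (g : Lat → ℝ≥0∞) (h : Lat → ℝ)
    (s : Lat → ℝ≥0)
    (hg : ∀ z ∈ B, (4 : ℝ≥0∞)⁻¹ * ∑ i, g (nb i z) + s z ≤ g z)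
    (hh : ∀ z ∈ B, 4 * h z ≤ ∑ i, h (nb i z) + 4 * s z)
    (hout : ∀ z, z ∉ B → ENNReal.ofReal (h z) ≤ g z) :
    ∀ z, ENNReal.ofReal (h z) ≤ g z := by
  by_contra hcon
  push Not at hcon
  obtain ⟨z0, hz0⟩ := hcon
  set S : Set Lat := {z | g z < ENNReal.ofReal (h z)} with hS
  have hSB : S ⊆ B := by
    intro z hz
    by_contra hzB
    exact absurd (hout z hzB) (not_le.2 hz)
  have hSf : S.Finite := hB.subset hSB
  set φ : Lat → ℝ := fun z => h z - (g z).toReal with hφ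
  obtain ⟨z1, hz1S, hz1⟩ := Set.exists_max_image S φ hSf ⟨z0, hz0⟩
  set S' : Set Lat := {z | z ∈ S ∧ φ z = φ z1} with hS'
  have hS'f : S'.Finite := hSf.subset fun z hz => hz.1
  obtain ⟨z, hzS', hzmax⟩ := Set.exists_max_image S' (fun z => z.1) hS'f ⟨z1, hz1S, rfl⟩
  have hzS : z ∈ S := hzS'.1
  have hzφ : φ z = φ z1 := hzS'.2
  have hzB := hSB hzS
  have hgz : g z ≠ ∞ := ne_top_of_lt hzS
  have hsum : (4 : ℝ≥0∞)⁻¹ * ∑ i, g (nb i z) ≠ ∞ := by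
    refine ne_top_of_le_ne_top hgz (le_trans le_self_add (hg z hzB))
  have hnbsum : ∑ i, g (nb i z) ≠ ∞ := by
    intro htop
    rw [htop, ENNReal.mul_top (by simp)] at hsum
    exact hsum rfl
  have hnb : ∀ i, g (nb i z) ≠ ∞ := fun i =>
    (ENNReal.sum_ne_top.1 hnbsum) i (Finset.mem_univ i)
  have hgr : (4 : ℝ)⁻¹ * ∑ i, (g (nb i z)).toReal + s z ≤ (g z).toReal := by
    have := ENNReal.toReal_mono hgz (hg z hzB)
    rw [ENNReal.toReal_add hsum (by simp), ENNReal.toReal_mul, ENNReal.toReal_sum (fun i _ => hnb i)] at this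
    simpa using this
  have hpos : 0 < φ z := by
    have h1 : g z < ENNReal.ofReal (h z) := hzS
    have := (ENNReal.lt_ofReal_iff_toReal_lt hgz).1 h1
    simp only [hφ]; linarith
  have hle : ∀ i, φ (nb i z) ≤ φ z := by
    intro i
    by_cases hi : nb i z ∈ S
    · rw [hzφ]; exact hz1 _ hi
    · have h1 : ENNReal.ofReal (h (nb i z)) ≤ g (nb i z) := not_lt.1 hi
      have := (ENNReal.ofReal_le_iff_le_toReal (hnb i)).1 h1
      simp only [hφ] at hpos ⊢; linarith
  have htot : 4 * φ z ≤ ∑ i, φ (nb i z) := by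
    have := hh z hzB
    simp only [hφ, Finset.sum_sub_distrib]
    linarith
  have h0 : φ (nb 0 z) = φ z := by
    have e0 := hle 0
    have e1 := hle 1
    have e2 := hle 2
    have e3 := hle 3
    rw [Fin.sum_univ_four] at htot
    linarith
  have h0S : nb 0 z ∈ S := by
    by_contra hi
    have h1 : ENNReal.ofReal (h (nb 0 z)) ≤ g (nb 0 z) := not_lt.1 hi
    have := (ENNReal.ofReal_le_iff_le_toReal (hnb 0)).1 h1
    rw [← h0] at hpos
    simp only [hφ] at hpos; linarith
  have := hzmax (nb 0 z) ⟨h0S, h0.trans hzφ⟩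
  simp [nb] at this

/-- Squared Euclidean distance between lattice points. -/
def sqd (w z : Lat) : ℝ := ((z.1 : ℝ) - w.1) ^ 2 + ((z.2 : ℝ) - w.2) ^ 2

theorem sqd_nonneg (w z : Lat) : 0 ≤ sqd w z := by unfold sqd; positivity

theorem ball_finite (w : Lat) (R : ℝ) : {z : Lat | sqd w z < R}.Finite := by
  obtain ⟨N, hN⟩ := exists_nat_gt R
  refine ((Set.finite_Icc (w.1 - N - 1) (w.1 + N + 1)).prod
    (Set.finite_Icc (w.2 - N - 1) (w.2 + N + 1))).subset ?_
  intro z hz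
  have hz' : ((z.1 : ℝ) - w.1) ^ 2 + ((z.2 : ℝ) - w.2) ^ 2 < N := lt_trans hz hN
  have hz2 : (z.1 - w.1) ^ 2 + (z.2 - w.2) ^ 2 < (N : ℤ) := by exact_mod_cast hz'
  simp only [Set.mem_prod, Set.mem_Icc]
  refine ⟨⟨?_, ?_⟩, ⟨?_, ?_⟩⟩ <;>
    nlinarith [sq_nonneg (z.1 - w.1), sq_nonneg (z.2 - w.2)]

theorem sqd_nb (w z : Lat) :
    sqd w (nb 0 z) = sqd w z + 1 + 2 * ((z.1 : ℝ) - w.1) ∧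
    sqd w (nb 1 z) = sqd w z + 1 - 2 * ((z.1 : ℝ) - w.1) ∧
    sqd w (nb 2 z) = sqd w z + 1 + 2 * ((z.2 : ℝ) - w.2) ∧
    sqd w (nb 3 z) = sqd w z + 1 - 2 * ((z.2 : ℝ) - w.2) := by
  simp only [sqd, nb]
  refine ⟨?_, ?_, ?_, ?_⟩ <;> simp <;> ring

theorem sqd_pos_ge {w z : Lat} (h : z ≠ w) : 1 ≤ sqd w z := by
  have h1 : 1 ≤ (z.1 - w.1) ^ 2 + (z.2 - w.2) ^ 2 := by
    by_contra hc
    push Not at hc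
    have a1 : (z.1 - w.1) ^ 2 = 0 := by nlinarith [sq_nonneg (z.1 - w.1), sq_nonneg (z.2 - w.2)]
    have a2 : (z.2 - w.2) ^ 2 = 0 := by nlinarith [sq_nonneg (z.1 - w.1), sq_nonneg (z.2 - w.2)]
    have b1 := pow_eq_zero_iff (two_ne_zero) |>.1 a1
    have b2 := pow_eq_zero_iff (two_ne_zero) |>.1 a2
    exact h (Prod.ext (by omega) (by omega))
  unfold sqd
  exact_mod_cast h1

/-- The logarithmic barrier. -/
def logB (w z : Lat) : ℝ := if z = w then Real.log 126 else - Real.log (sqd w z - 1 / 2)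

/-- Subharmonicity of the logarithmic barrier. -/
theorem logB_sub (w z : Lat) :
    4 * logB w z ≤ ∑ i, logB w (nb i z) + if z = w then 20 else 0 := by
  have hnum : Real.log 126 - Real.log 2 ≤ 5 := by
    rw [← Real.log_div (by norm_num) (by norm_num)]
    rw [Real.log_le_iff_le_exp (by norm_num)]
    have := Real.exp_one_gt_d9
    have h5 : Real.exp 5 = Real.exp 1 ^ 5 := by rw [← Real.exp_nat_mul]; norm_num
    rw [h5]
    calc (126 / 2 : ℝ) ≤ 2.7 ^ 5 := by norm_num
      _ ≤ _ := by gcongr; linarith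
  by_cases hzw : z = w
  · subst hzw
    have hn : ∀ i, logB z (nb i z) = Real.log 2 := by
      intro i
      have hne : nb i z ≠ z := by
        fin_cases i <;> simp [nb, Prod.ext_iff]
      have : sqd z (nb i z) = 1 := by
        fin_cases i <;> simp [nb, sqd]
      rw [logB, if_neg hne, this, ← Real.log_inv]
      norm_num
    rw [Fin.sum_univ_four, hn, hn, hn, hn, logB, if_pos rfl, if_pos rfl]
    linarith
  · rw [if_neg hzw, add_zero]
    have hs := sqd_pos_ge hzw
    obtain ⟨h0, h1, h2, h3⟩ := sqd_nb w z
    set a : ℝ := (z.1 : ℝ) - w.1 with ha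
    set b : ℝ := (z.2 : ℝ) - w.2 with hb
    set S := sqd w z with hSdef
    have hSab : S = a ^ 2 + b ^ 2 := rfl
    rw [Fin.sum_univ_four]
    have hz : logB w z = - Real.log (S - 1 / 2) := by rw [logB, if_neg hzw]
    by_cases hany : ∃ i, nb i z = w
    · obtain ⟨i, hi⟩ := hany
      have hS1 : S = 1 := by
        rw [hSdef, ← hi]; fin_cases i <;> simp [nb, sqd]
      have hw : ∀ j, j ≠ i → logB w (nb j z) = - Real.log (sqd w (nb j z) - 1 / 2) := by
        intro j hj
        rw [logB, if_neg]
        intro hjw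
        exact hj (nb_inj z (hjw.trans hi.symm))
      have hwi : logB w (nb i z) = Real.log 126 := by rw [logB, if_pos hi]
      have hfin : 4 * -Real.log (1 - 1 / 2) ≤
          Real.log 126 - Real.log (1 + 1 + 2 - 1 / 2) - 2 * Real.log (1 + 1 - 1 / 2) := by
        have e1 : -Real.log (1 - 1 / 2) = Real.log 2 := by rw [← Real.log_inv]; norm_num
        rw [e1]
        have e2 : 4 * Real.log 2 + Real.log (1 + 1 + 2 - 1 / 2) + 2 * Real.log (1 + 1 - 1 / 2)
            = Real.log 126 := by
          rw [show (4 : ℝ) * Real.log 2 = Real.log (2 ^ 4) by rw [Real.log_pow]; norm_num,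
            show (2 : ℝ) * Real.log (1 + 1 - 1 / 2) = Real.log ((1 + 1 - 1 / 2) ^ 2) by
              rw [Real.log_pow]; norm_num,
            ← Real.log_mul (by norm_num) (by norm_num), ← Real.log_mul (by norm_num) (by norm_num)]
          norm_num
        linarith
      rw [hz, hS1]
      fin_cases i
      · have hab : a = -1 ∧ b = 0 := by
          simp only [ha, hb, ← hi]; simp [nb]
        simp only [Fin.zero_eta] at hwi hw
        rw [hwi, hw 1 (by decide), hw 2 (by decide), hw 3 (by decide), h1, h2, h3, hS1, hab.1, hab.2]
        norm_num at hfin ⊢; linarith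
      · have hab : a = 1 ∧ b = 0 := by
          simp only [ha, hb, ← hi]; simp [nb]
        simp only [Fin.mk_one] at hwi hw
        rw [hwi, hw 0 (by decide), hw 2 (by decide), hw 3 (by decide), h0, h2, h3, hS1, hab.1, hab.2]
        norm_num at hfin ⊢; linarith
      · have hab : a = 0 ∧ b = -1 := by
          simp only [ha, hb, ← hi]; simp [nb]
        simp only [Fin.reduceFinMk] at hwi hw
        rw [hwi, hw 0 (by decide), hw 1 (by decide), hw 3 (by decide), h0, h1, h3, hS1, hab.1, hab.2]
        norm_num at hfin ⊢; linarith
      · have hab : a = 0 ∧ b = 1 := by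
          simp only [ha, hb, ← hi]; simp [nb]
        simp only [Fin.reduceFinMk] at hwi hw
        rw [hwi, hw 0 (by decide), hw 1 (by decide), hw 2 (by decide), h0, h1, h2, hS1, hab.1, hab.2]
        norm_num at hfin ⊢; linarith
    · push Not at hany
      have hw : ∀ j, logB w (nb j z) = - Real.log (sqd w (nb j z) - 1 / 2) := by
        intro j
        rw [logB, if_neg (hany j)]
      have hp : ∀ j, 0 < sqd w (nb j z) - 1 / 2 := by
        intro j
        have := sqd_pos_ge (hany j); linarith
      have p0 := hp 0
      have p1 := hp 1
      have p2 := hp 2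
      have p3 := hp 3
      rw [hz, hw, hw, hw, hw]
      rw [h0] at p0 ⊢
      rw [h1] at p1 ⊢
      rw [h2] at p2 ⊢
      rw [h3] at p3 ⊢
      have hu : 0 < S - 1 / 2 := by linarith
      have key : Real.log ((S + 1 + 2 * a - 1 / 2) * (S + 1 - 2 * a - 1 / 2) *
          ((S + 1 + 2 * b - 1 / 2) * (S + 1 - 2 * b - 1 / 2))) ≤ Real.log ((S - 1 / 2) ^ 4) := by
        refine Real.log_le_log (by positivity) ?_
        have : (S - 1 / 2) ^ 4 - (S + 1 + 2 * a - 1 / 2) * (S + 1 - 2 * a - 1 / 2) *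
          ((S + 1 + 2 * b - 1 / 2) * (S + 1 - 2 * b - 1 / 2)) = 4 * (a ^ 2 - b ^ 2) ^ 2 := by
          rw [hSab]; ring
        nlinarith [sq_nonneg (a ^ 2 - b ^ 2)]
      rw [Real.log_pow, Real.log_mul (by positivity) (by positivity),
        Real.log_mul (by positivity) (by positivity), Real.log_mul (by positivity) (by positivity)] at key
      push_cast at key
      linarith

theorem green_local (D : Set Lat) (y : Lat) (r : ℝ) (hr : 1 ≤ r)
    (hD : ∀ z, sqd y z < r ^ 2 → z ∈ D) :
    ∀ z, 16 * sqd y z ≤ r ^ 2 → ENNReal.ofReal (1 / 2) ≤ green D z y := by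
  have hr2 : 1 ≤ r ^ 2 := by nlinarith
  have main := comparison {z | sqd y z < r ^ 2} (ball_finite y _) (fun z => green D z y)
    (fun z => (logB y z + Real.log (r ^ 2 - 1 / 2)) / 5) (fun z => if z = y then 1 else 0) ?_ ?_ ?_
  · intro z hz
    refine le_trans (ENNReal.ofReal_le_ofReal ?_) (main z)
    have h16 : (5 / 2 : ℝ) ≤ Real.log 16 := by
      have := Real.log_two_gt_d9
      rw [show (16 : ℝ) = 2 ^ 4 by norm_num, Real.log_pow]
      push_cast; linarith
    rw [logB]
    split_ifs with h
    · have h1 : Real.log (1 / 2) ≤ Real.log (r ^ 2 - 1 / 2) :=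
        Real.log_le_log (by norm_num) (by linarith)
      have h2 : Real.log 126 + Real.log (1 / 2) = Real.log 63 := by
        rw [← Real.log_mul (by norm_num) (by norm_num)]; norm_num
      have h3 : Real.log 16 ≤ Real.log 63 := Real.log_le_log (by norm_num) (by norm_num)
      linarith
    · have hs := sqd_pos_ge h
      have h1 : Real.log (16 * (sqd y z - 1 / 2)) ≤ Real.log (r ^ 2 - 1 / 2) :=
        Real.log_le_log (by linarith) (by linarith)
      rw [Real.log_mul (by norm_num) (by linarith)] at h1
      linarith
  · intro z hz
    refine le_trans (le_of_eq ?_) (green_super D z y (hD z hz))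
    congr 1
    split_ifs <;> simp
  · intro z hz
    have := logB_sub y z
    simp only [← Finset.sum_div, Finset.sum_add_distrib]
    simp only [Finset.sum_const, Finset.card_univ, Fintype.card_fin, nsmul_eq_mul]
    split_ifs at this ⊢
    · push_cast; linarith
    · push_cast; linarith
  · intro z hz
    have hz' : r ^ 2 ≤ sqd y z := not_lt.1 hz
    rw [ENNReal.ofReal_of_nonpos]
    · exact zero_le
    · have hne : z ≠ y := by
        rintro rfl
        simp [sqd] at hz'; linarith
      rw [logB, if_neg hne]
      have := Real.log_le_log (show 0 < r ^ 2 - 1 / 2 by linarith)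
        (show r ^ 2 - 1 / 2 ≤ sqd y z - 1 / 2 by linarith)
      linarith

/-- The Harnack-type constant. -/
def kap : ℝ := Real.exp (-8) - Real.exp (-32)

theorem kap_pos : 0 < kap := by
  unfold kap
  have := Real.exp_lt_exp.2 (show (-32 : ℝ) < -8 by norm_num)
  linarith

theorem cosh_lb (t : ℝ) : 2 + t ^ 2 ≤ Real.exp t + Real.exp (-t) := by
  have h1 : (t / 2) ^ 2 ≤ Real.sinh (t / 2) ^ 2 := by
    rw [sq_le_sq, Real.abs_sinh]
    exact Real.self_le_sinh_iff.2 (abs_nonneg _)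
  have h2 := Real.cosh_two_mul (t / 2)
  have h3 := Real.cosh_sq (t / 2)
  rw [show 2 * (t / 2) = t by ring, Real.cosh_eq] at h2
  linarith

theorem green_spread (D : Set Lat) (y w : Lat) (r c : ℝ) (hr : 6 ≤ r) (hc : 0 < c)
    (hD : ∀ z, sqd w z < r ^ 2 → z ∈ D)
    (hin : ∀ z, 16 * sqd w z ≤ r ^ 2 → ENNReal.ofReal c ≤ green D z y) :
    ∀ z, 4 * sqd w z ≤ r ^ 2 → ENNReal.ofReal (kap * c) ≤ green D z y := by
  have hr2 : 36 ≤ r ^ 2 := by nlinarith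
  set α : ℝ := 32 / r ^ 2 with hα
  have hαpos : 0 < α := by positivity
  have hα1 : α ≤ 1 := by rw [hα, div_le_one (by positivity)]; linarith
  have hαr : α * r ^ 2 = 32 := by rw [hα]; field_simp
  have main := comparison {z | sqd w z < r ^ 2 ∧ r ^ 2 < 16 * sqd w z}
    ((ball_finite w (r ^ 2)).subset fun z hz => hz.1) (fun z => green D z y)
    (fun z => c * (Real.exp (-(α * sqd w z)) - Real.exp (-32))) (fun _ => 0) ?_ ?_ ?_
  · intro z hz
    refine le_trans (ENNReal.ofReal_le_ofReal ?_) (main z)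
    have h1 : α * sqd w z ≤ 8 := by nlinarith
    have h2 : Real.exp (-8) ≤ Real.exp (-(α * sqd w z)) := Real.exp_le_exp.2 (by linarith)
    rw [mul_comm]
    unfold kap
    gcongr
  · intro z hz
    refine le_trans ?_ (green_super D z y (hD z hz.1))
    simp
  · intro z hz
    obtain ⟨h0, h1, h2, h3⟩ := sqd_nb w z
    set a : ℝ := (z.1 : ℝ) - w.1 with ha
    set b : ℝ := (z.2 : ℝ) - w.2 with hb
    set S := sqd w z with hSdef
    have hSab : S = a ^ 2 + b ^ 2 := rfl
    have hαS : 2 ≤ α * S := by nlinarith [hz.2]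
    rw [Fin.sum_univ_four, h0, h1, h2, h3]
    have hE : 0 < Real.exp (-(α * S)) := Real.exp_pos _
    have e0 : Real.exp (-(α * (S + 1 + 2 * a))) =
      Real.exp (-(α * S)) * Real.exp (-α) * Real.exp (-(2 * α * a)) := by
      rw [← Real.exp_add, ← Real.exp_add]; ring_nf
    have e1 : Real.exp (-(α * (S + 1 - 2 * a))) =
      Real.exp (-(α * S)) * Real.exp (-α) * Real.exp (2 * α * a) := by
      rw [← Real.exp_add, ← Real.exp_add]; ring_nf
    have e2 : Real.exp (-(α * (S + 1 + 2 * b))) =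
      Real.exp (-(α * S)) * Real.exp (-α) * Real.exp (-(2 * α * b)) := by
      rw [← Real.exp_add, ← Real.exp_add]; ring_nf
    have e3 : Real.exp (-(α * (S + 1 - 2 * b))) =
      Real.exp (-(α * S)) * Real.exp (-α) * Real.exp (2 * α * b) := by
      rw [← Real.exp_add, ← Real.exp_add]; ring_nf
    rw [e0, e1, e2, e3]
    have ca := cosh_lb (2 * α * a)
    have cb := cosh_lb (2 * α * b)
    have hsum : 4 * Real.exp α ≤ Real.exp (2 * α * a) + Real.exp (-(2 * α * a)) +
        (Real.exp (2 * α * b) + Real.exp (-(2 * α * b))) := by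
      have hx : Real.exp α ≤ 1 + 2 * α := by
        have := Real.abs_exp_sub_one_le (x := α) (by rw [abs_of_pos hαpos]; exact hα1)
        rw [abs_of_pos hαpos] at this
        have := le_abs_self (Real.exp α - 1)
        linarith
      have : 4 * α ^ 2 * S ≥ 8 * α := by nlinarith
      rw [hSab] at this
      nlinarith
    have hpp : Real.exp (-α) * Real.exp α = 1 := by rw [← Real.exp_add]; simp
    have hm : 4 ≤ Real.exp (-α) * (Real.exp (2 * α * a) + Real.exp (-(2 * α * a)) +
        (Real.exp (2 * α * b) + Real.exp (-(2 * α * b)))) := by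
      have := mul_le_mul_of_nonneg_left hsum (Real.exp_pos (-α)).le
      linarith
    have hm2 := mul_le_mul_of_nonneg_left hm (mul_pos hc hE).le
    simp only [NNReal.coe_zero, mul_zero, add_zero]
    linarith
  · intro z hz
    by_cases hz1 : sqd w z < r ^ 2
    · have hz2 : 16 * sqd w z ≤ r ^ 2 := by
        by_contra hcon
        exact hz ⟨hz1, not_le.1 hcon⟩
      refine le_trans (ENNReal.ofReal_le_ofReal ?_) (hin z hz2)
      have : Real.exp (-(α * sqd w z)) ≤ 1 := by
        rw [Real.exp_le_one_iff]
        have := mul_nonneg hαpos.le (sqd_nonneg w z)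
        linarith
      have := Real.exp_pos (-32)
      nlinarith
    · rw [ENNReal.ofReal_of_nonpos]
      · exact zero_le
      · have h1 : 32 ≤ α * sqd w z := by
          rw [← hαr]; exact mul_le_mul_of_nonneg_left (not_lt.1 hz1) hαpos.le
        have : Real.exp (-(α * sqd w z)) ≤ Real.exp (-32) := Real.exp_le_exp.2 (by linarith)
        nlinarith

/-- Unit lattice edges, oriented. -/
def UEdge (w w' : Lat) : Prop := w' = (w.1 + 1, w.2) ∨ w' = (w.1, w.2 + 1)

/-- The closed unit edge, as a subset of the plane. -/
def edgeSet (w w' : Lat) : Set Plane :=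
  {p | (w.1 : ℝ) ≤ p 0 ∧ p 0 ≤ (w'.1 : ℝ) ∧ (w.2 : ℝ) ≤ p 1 ∧ p 1 ≤ (w'.2 : ℝ)}

theorem UEdge.adj {w w' : Lat} (h : UEdge w w') : Adj w w' := by
  rcases h with rfl | rfl <;> simp [Adj]

theorem adj_symm {a b : Lat} (h : Adj a b) : Adj b a := by
  unfold Adj at *; rw [← h]; ring

theorem emb_zero (w : Lat) : emb w 0 = (w.1 : ℝ) := by simp [emb]
theorem emb_one (w : Lat) : emb w 1 = (w.2 : ℝ) := by simp [emb]

theorem plane_ext {p q : Plane} (h0 : p 0 = q 0) (h1 : p 1 = q 1) : p = q := by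
  ext i; fin_cases i
  · exact h0
  · exact h1

theorem emb_inj {a b : Lat} (h : emb a = emb b) : a = b := by
  have h0 := congrArg (fun p : Plane => p 0) h
  have h1 := congrArg (fun p : Plane => p 1) h
  simp only [emb_zero, emb_one] at h0 h1
  exact Prod.ext (by exact_mod_cast h0) (by exact_mod_cast h1)

theorem isClosed_edgeSet (w w' : Lat) : IsClosed (edgeSet w w') := by
  have c0 : Continuous fun p : Plane => p 0 := by fun_prop
  have c1 : Continuous fun p : Plane => p 1 := by fun_prop
  exact (isClosed_le continuous_const c0).inter ((isClosed_le c0 continuous_const).inter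
    ((isClosed_le continuous_const c1).inter (isClosed_le c1 continuous_const)))

theorem edge_inter {w w' v v' : Lat} (h : UEdge w w') (k : UEdge v v') {p : Plane}
    (hp : p ∈ edgeSet w w') (kp : p ∈ edgeSet v v') :
    (w = v ∧ w' = v') ∨ ∃ u, emb u = p ∧ (u = w ∨ u = w') ∧ (u = v ∨ u = v') := by
  obtain ⟨a, b⟩ := w
  obtain ⟨c, d⟩ := v
  obtain ⟨a1, a2, a3, a4⟩ := hp
  obtain ⟨b1, b2, b3, b4⟩ := kp
  rcases h with rfl | rfl <;> rcases k with rfl | rfl <;>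
    simp only [Int.cast_add, Int.cast_one] at a1 a2 a3 a4 b1 b2 b3 b4
  · have e : b = d := by
      have : (b : ℝ) = d := by linarith
      exact_mod_cast this
    subst e
    have e1 : c ≤ a + 1 := by
      have : (c : ℝ) ≤ a + 1 := by linarith
      exact_mod_cast this
    have e2 : a ≤ c + 1 := by
      have : (a : ℝ) ≤ c + 1 := by linarith
      exact_mod_cast this
    rcases (by omega : c = a ∨ c = a + 1 ∨ a = c + 1) with rfl | rfl | rfl
    · left; simp
    · right
      push_cast at *
      refine ⟨(a + 1, b), plane_ext ?_ ?_, by simp, by simp⟩ <;>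
        simp only [emb_zero, emb_one] <;> push_cast <;> linarith
    · right
      push_cast at *
      refine ⟨(c + 1, b), plane_ext ?_ ?_, by simp, by simp⟩ <;>
        simp only [emb_zero, emb_one] <;> push_cast <;> linarith
  · right
    have f1 : d ≤ b := by
      have : (d : ℝ) ≤ b := by linarith
      exact_mod_cast this
    have f2 : b ≤ d + 1 := by
      have : (b : ℝ) ≤ d + 1 := by linarith
      exact_mod_cast this
    have f3 : a ≤ c := by
      have : (a : ℝ) ≤ c := by linarith
      exact_mod_cast this
    have f4 : c ≤ a + 1 := by
      have : (c : ℝ) ≤ a + 1 := by linarith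
      exact_mod_cast this
    refine ⟨(c, b), plane_ext ?_ ?_, ?_, ?_⟩
    · simp only [emb_zero]; linarith
    · simp only [emb_one]; linarith
    · simp only [Prod.mk.injEq, true_and, and_true]; omega
    · simp only [Prod.mk.injEq, true_and, and_true]; omega
  · right
    have f1 : b ≤ d := by
      have : (b : ℝ) ≤ d := by linarith
      exact_mod_cast this
    have f2 : d ≤ b + 1 := by
      have : (d : ℝ) ≤ b + 1 := by linarith
      exact_mod_cast this
    have f3 : c ≤ a := by
      have : (c : ℝ) ≤ a := by linarith
      exact_mod_cast this
    have f4 : a ≤ c + 1 := by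
      have : (a : ℝ) ≤ c + 1 := by linarith
      exact_mod_cast this
    refine ⟨(a, d), plane_ext ?_ ?_, ?_, ?_⟩
    · simp only [emb_zero]; linarith
    · simp only [emb_one]; linarith
    · simp only [Prod.mk.injEq, true_and, and_true]; omega
    · simp only [Prod.mk.injEq, true_and, and_true]; omega
  · have e : a = c := by
      have : (a : ℝ) = c := by linarith
      exact_mod_cast this
    subst e
    have e1 : d ≤ b + 1 := by
      have : (d : ℝ) ≤ b + 1 := by linarith
      exact_mod_cast this
    have e2 : b ≤ d + 1 := by
      have : (b : ℝ) ≤ d + 1 := by linarith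
      exact_mod_cast this
    rcases (by omega : d = b ∨ d = b + 1 ∨ b = d + 1) with rfl | rfl | rfl
    · left; simp
    · right
      push_cast at *
      refine ⟨(a, b + 1), plane_ext ?_ ?_, by simp, by simp⟩ <;>
        simp only [emb_zero, emb_one] <;> push_cast <;> linarith
    · right
      push_cast at *
      refine ⟨(a, d + 1), plane_ext ?_ ?_, by simp, by simp⟩ <;>
        simp only [emb_zero, emb_one] <;> push_cast <;> linarith

/-- Integer cell containing a real in `[-n,n]`. -/
theorem exists_cell {n : ℤ} (hn : 1 ≤ n) {t : ℝ} (ht : |t| ≤ n) :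
    ∃ k : ℤ, |k| ≤ n ∧ |k + 1| ≤ n ∧ (k : ℝ) ≤ t ∧ t ≤ (k : ℝ) + 1 := by
  obtain ⟨h1, h2⟩ := abs_le.1 ht
  by_cases h : t = n
  · refine ⟨n - 1, ?_, ?_, ?_, ?_⟩
    · rw [abs_le]; omega
    · rw [abs_le]; omega
    · push_cast; linarith
    · push_cast; linarith
  · have h3 : t < n := lt_of_le_of_ne h2 h
    have h4 : ⌊t⌋ < n := Int.floor_lt.2 h3
    have h5 : -n ≤ ⌊t⌋ := Int.le_floor.2 (by push_cast; exact h1)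
    refine ⟨⌊t⌋, ?_, ?_, Int.floor_le t, (Int.lt_floor_add_one t).le⟩
    · rw [abs_le]; omega
    · rw [abs_le]; omega

theorem cover {n : ℤ} (hn : 1 ≤ n) {p : Plane} (hp : p ∈ sqCurve n) :
    ∃ w w', UEdge w w' ∧ linf w = n ∧ linf w' = n ∧ p ∈ edgeSet w w' := by
  have hp' : max |p 0| |p 1| = (n : ℝ) := hp
  have hn0 : (0 : ℝ) ≤ n := by exact_mod_cast (by omega : 0 ≤ n)
  rcases max_choice |p 0| |p 1| with h | h
  · rw [h] at hp'
    have h1 : |p 1| ≤ n := by rw [← hp', ← h]; exact le_max_right _ _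
    obtain ⟨k, k1, k2, k3, k4⟩ := exists_cell hn h1
    obtain ⟨m, hm, hm'⟩ : ∃ m : ℤ, |m| = n ∧ p 0 = m := by
      rcases (abs_eq hn0).1 hp' with h | h
      · exact ⟨n, abs_of_nonneg (by omega), h⟩
      · exact ⟨-n, by rw [abs_neg]; exact abs_of_nonneg (by omega), by push_cast; exact h⟩
    refine ⟨(m, k), (m, k + 1), Or.inr rfl, ?_, ?_, ?_⟩
    · simp only [linf]; omega
    · simp only [linf]; omega
    · exact ⟨by simp [hm'], by simp [hm'], k3, by push_cast; exact k4⟩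
  · rw [h] at hp'
    have h1 : |p 0| ≤ n := by rw [← hp', ← h]; exact le_max_left _ _
    obtain ⟨k, k1, k2, k3, k4⟩ := exists_cell hn h1
    obtain ⟨m, hm, hm'⟩ : ∃ m : ℤ, |m| = n ∧ p 1 = m := by
      rcases (abs_eq hn0).1 hp' with h | h
      · exact ⟨n, abs_of_nonneg (by omega), h⟩
      · exact ⟨-n, by rw [abs_neg]; exact abs_of_nonneg (by omega), by push_cast; exact h⟩
    refine ⟨(k, m), (k + 1, m), Or.inl rfl, ?_, ?_, ?_⟩
    · simp only [linf]; omega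
    · simp only [linf]; omega
    · exact ⟨k3, by push_cast; exact k4, by simp [hm'], by simp [hm']⟩

/-- The four sides of the lattice square, as a finite set. -/
def sqF (n : ℤ) : Finset Lat :=
  ((({n} : Finset ℤ) ×ˢ Finset.Icc (-n) n) ∪ (({-n} : Finset ℤ) ×ˢ Finset.Icc (-n) n)) ∪
  ((Finset.Icc (-n) n ×ˢ ({n} : Finset ℤ)) ∪ (Finset.Icc (-n) n ×ˢ ({-n} : Finset ℤ)))

theorem mem_sqF {n : ℤ} {w : Lat} (h : linf w = n) : w ∈ sqF n := by
  obtain ⟨a, b⟩ := w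
  simp only [linf] at h
  simp only [sqF, Finset.mem_union, Finset.mem_product, Finset.mem_singleton, Finset.mem_Icc]
  rcases abs_cases a with ha | ha <;> rcases abs_cases b with hb | hb <;> omega

theorem card_sqF {n : ℤ} (hn : 1 ≤ n) : ((sqF n).card : ℤ) ≤ 12 * n := by
  have h1 : (sqF n).card ≤ 4 * (2 * n + 1).toNat := by
    unfold sqF
    have e : (n + 1 - -n).toNat = (2 * n + 1).toNat := by congr 1; ring
    refine (Finset.card_union_le _ _).trans ?_
    refine (Nat.add_le_add (Finset.card_union_le _ _) (Finset.card_union_le _ _)).trans ?_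
    simp only [Finset.card_product, Finset.card_singleton, Int.card_Icc, e]
    omega
  omega

theorem exists_lattice_path {n : ℤ} (hn : 1 ≤ n) {J : Set Plane} (hJ : IsPreconnected J)
    (hJs : J ⊆ sqCurve n) {x y : Lat} (hx : emb x ∈ J) (hy : emb y ∈ J) :
    ∃ (L : ℕ) (v : ℕ → Lat), (L : ℤ) ≤ 12 * n ∧ v 0 = y ∧ v L = x ∧ (∀ i, emb (v i) ∈ J) ∧
      ∀ i < L, Adj (v i) (v (i + 1)) := by
  have hlin : ∀ w, emb w ∈ J → linf w = n := by
    intro w hw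
    have : max |emb w 0| |emb w 1| = (n : ℝ) := hJs hw
    rw [emb_zero, emb_one] at this
    have h2 : ((max |w.1| |w.2| : ℤ) : ℝ) = (n : ℝ) := by push_cast; exact this
    exact_mod_cast h2
  set V := {w : Lat // emb w ∈ J} with hV
  have hinjV : Function.Injective (fun w : V => (⟨w.1, mem_sqF (hlin w.1 w.2)⟩ : sqF n)) := by
    intro a b h
    simp only [Subtype.mk.injEq] at h
    exact Subtype.ext h
  have : Finite V := Finite.of_injective _ hinjV
  have : Fintype V := Fintype.ofFinite V
  have hcard : Fintype.card V ≤ (sqF n).card := by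
    have := Fintype.card_le_of_injective _ hinjV
    simpa using this
  let G : SimpleGraph V :=
    { Adj := fun a b => Adj a.1 b.1
      symm := ⟨fun a b h => adj_symm h⟩
      loopless := ⟨fun a h => by simp [Adj] at h⟩ }
  set A : Set Lat := {w | ∃ hw : emb w ∈ J, G.Reachable ⟨y, hy⟩ ⟨w, hw⟩} with hA
  have hstep : ∀ a b, a ∈ A → emb b ∈ J → Adj a b → b ∈ A := by
    rintro a b ⟨ha, hra⟩ hb hab
    refine ⟨hb, hra.trans (SimpleGraph.Adj.reachable ?_)⟩
    exact hab
  have hyA : y ∈ A := ⟨hy, SimpleGraph.Reachable.refl _⟩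
  have hxA : x ∈ A := by
    by_contra hxA
    set I : Set (Lat × Lat) := {e | e ∈ (sqF n ×ˢ sqF n : Finset (Lat × Lat)) ∧ UEdge e.1 e.2} with hI
    have hIf : I.Finite := (Finset.finite_toSet _).subset fun e he => he.1
    set I1 : Set (Lat × Lat) := {e | e ∈ I ∧ (e.1 ∈ A ∨ e.2 ∈ A)}
    set I2 : Set (Lat × Lat) := {e | e ∈ I ∧ ¬ (e.1 ∈ A ∨ e.2 ∈ A)}
    have c1 : IsClosed (⋃ e ∈ I1, edgeSet e.1 e.2) :=
      (hIf.subset fun e he => he.1).isClosed_biUnion fun e _ => isClosed_edgeSet _ _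
    have c2 : IsClosed (⋃ e ∈ I2, edgeSet e.1 e.2) :=
      (hIf.subset fun e he => he.1).isClosed_biUnion fun e _ => isClosed_edgeSet _ _
    have hcov : ∀ p ∈ J, ∃ e ∈ I, p ∈ edgeSet e.1 e.2 := by
      intro p hp
      obtain ⟨w, w', h1, h2, h3, h4⟩ := cover hn (hJs hp)
      exact ⟨(w, w'), ⟨Finset.mem_product.2 ⟨mem_sqF h2, mem_sqF h3⟩, h1⟩, h4⟩
    -- a lattice point lying on an edge is one of its endpoints
    have hend : ∀ (u : Lat) (e : Lat × Lat), UEdge e.1 e.2 → emb u ∈ edgeSet e.1 e.2 →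
        u = e.1 ∨ u = e.2 := by
      rintro ⟨u1, u2⟩ ⟨⟨a, b⟩, w'⟩ he hu
      obtain ⟨q1, q2, q3, q4⟩ := hu
      simp only [emb_zero, emb_one, Int.cast_le] at q1 q2 q3 q4
      rcases he with he | he <;> simp only at he q1 q2 q3 q4 ⊢ <;> subst he <;>
        simp only [Prod.mk.injEq] at * <;> omega
    have hsep := isPreconnected_closed_iff.1 hJ _ _ c1 c2 ?_ ?_ ?_
    · obtain ⟨p, hpJ, hp1, hp2⟩ := hsep
      simp only [Set.mem_iUnion, exists_prop] at hp1 hp2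
      obtain ⟨e, ⟨heI, heA⟩, hep⟩ := hp1
      obtain ⟨f, ⟨hfI, hfA⟩, hfp⟩ := hp2
      rcases edge_inter heI.2 hfI.2 hep hfp with ⟨h1, h2⟩ | ⟨u, rfl, h1, h2⟩
      · rw [h1, h2] at heA; exact hfA heA
      · have huA : u ∈ A := by
          rcases h1 with h1 | h1 <;> rcases heA with heA | heA
          · rwa [h1]
          · exact hstep _ _ heA hpJ (by rw [h1]; exact adj_symm heI.2.adj)
          · exact hstep _ _ heA hpJ (by rw [h1]; exact heI.2.adj)
          · rwa [h1]
        rcases h2 with rfl | rfl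
        · exact hfA (Or.inl huA)
        · exact hfA (Or.inr huA)
    · intro p hp
      obtain ⟨e, he, hpe⟩ := hcov p hp
      simp only [Set.mem_union, Set.mem_iUnion, exists_prop]
      by_cases h : e.1 ∈ A ∨ e.2 ∈ A
      · exact Or.inl ⟨e, ⟨he, h⟩, hpe⟩
      · exact Or.inr ⟨e, ⟨he, h⟩, hpe⟩
    · obtain ⟨e, he, hpe⟩ := hcov _ hy
      refine ⟨_, hy, ?_⟩
      simp only [Set.mem_iUnion, exists_prop]
      refine ⟨e, ⟨he, ?_⟩, hpe⟩
      rcases hend _ _ he.2 hpe with h | h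
      · left; rwa [← h]
      · right; rwa [← h]
    · obtain ⟨e, he, hpe⟩ := hcov _ hx
      refine ⟨_, hx, ?_⟩
      simp only [Set.mem_iUnion, exists_prop]
      refine ⟨e, ⟨he, ?_⟩, hpe⟩
      intro hor
      apply hxA
      rcases hend _ _ he.2 hpe with h | h <;> rcases hor with hor | hor
      · rwa [h]
      · exact hstep _ _ hor hx (by rw [h]; exact adj_symm he.2.adj)
      · exact hstep _ _ hor hx (by rw [h]; exact he.2.adj)
      · rwa [h]
  obtain ⟨hx', ⟨p⟩⟩ := hxA
  set q := p.toPath with hq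
  refine ⟨q.1.length, fun i => (q.1.getVert i).1, ?_, ?_, ?_, ?_, ?_⟩
  · have h1 := q.2.length_lt
    have h2 := card_sqF hn
    omega
  · simp
  · simp
  · intro i
    exact (q.1.getVert i).2
  · intro i hi
    exact q.1.adj_getVert_succ hi

theorem dist_emb (a b : Lat) : dist (emb a) (emb b) = Real.sqrt (sqd b a) := by
  rw [EuclideanSpace.dist_eq, Fin.sum_univ_two, Real.dist_eq, Real.dist_eq, sq_abs, sq_abs]
  simp only [emb_zero, emb_one, sqd]

theorem dist_emb_sq (a b : Lat) : dist (emb a) (emb b) ^ 2 = sqd b a := by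
  rw [dist_emb, Real.sq_sqrt (sqd_nonneg _ _)]

theorem dist_adj {a b : Lat} (h : Adj a b) : dist (emb a) (emb b) = 1 := by
  rw [dist_emb, Real.sqrt_eq_one]
  unfold sqd
  exact_mod_cast h

theorem dist_path {v : ℕ → Lat} {L : ℕ} (hv : ∀ i < L, Adj (v i) (v (i + 1))) (i m : ℕ)
    (h : i + m ≤ L) : dist (emb (v i)) (emb (v (i + m))) ≤ m := by
  induction m with
  | zero => simp
  | succ m ih =>
    have h1 := ih (by omega)
    have h2 := dist_adj (hv (i + m) (by omega))
    have h3 := dist_triangle (emb (v i)) (emb (v (i + m))) (emb (v (i + m + 1)))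
    push_cast
    rw [← add_assoc]
    linarith

theorem green_small (D : Set Lat) (v : ℕ → Lat) (L : ℕ) (hD : ∀ i, v i ∈ D)
    (hv : ∀ i < L, Adj (v i) (v (i + 1))) (k : ℕ) (hk : k ≤ L) :
    (4 : ℝ≥0∞)⁻¹ ^ k ≤ green D (v k) (v 0) := by
  induction k with
  | zero =>
    refine le_trans ?_ (green_super D (v 0) (v 0) (hD 0))
    simp
  | succ k ih =>
    have h1 := ih (by omega)
    obtain ⟨i, hi⟩ := exists_nb_of_adj (adj_symm (hv k (by omega)))
    refine le_trans ?_ (green_super D (v (k + 1)) (v 0) (hD _))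
    refine le_trans ?_ le_self_add
    rw [pow_succ, mul_comm]
    gcongr
    refine h1.trans ?_
    rw [hi]
    exact Finset.single_le_sum (f := fun j => green D (nb j (v (k + 1))) (v 0))
      (fun _ _ => zero_le) (Finset.mem_univ i)

theorem green_chain (D : Set Lat) (v : ℕ → Lat) (L m : ℕ) (r : ℝ) (hr : 6 ≤ r)
    (hm : (m : ℝ) ≤ r / 4)
    (hD : ∀ i z, sqd (v i) z < r ^ 2 → z ∈ D)
    (hv : ∀ i < L, Adj (v i) (v (i + 1))) (k : ℕ) :
    ∀ z, 16 * sqd (v (min (k * m) L)) z ≤ r ^ 2 →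
      ENNReal.ofReal (kap ^ k * (1 / 2)) ≤ green D z (v 0) := by
  induction k with
  | zero =>
    intro z hz
    simp only [zero_mul, zero_le, inf_of_le_left] at hz
    simpa using green_local D (v 0) r (by linarith) (hD 0) z hz
  | succ k ih =>
    intro z hz
    have key := green_spread D (v 0) (v (min (k * m) L)) r (kap ^ k * (1 / 2)) hr
      (by have := kap_pos; positivity) (hD _) ih z ?_
    · rw [pow_succ, mul_comm (kap ^ k) kap, mul_assoc]; exact key
    · have hle : min (k * m) L ≤ min ((k + 1) * m) L := by
        rw [add_mul, one_mul]; omega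
      have hle2 : min ((k + 1) * m) L ≤ min (k * m) L + m := by
        rw [add_mul, one_mul]; omega
      obtain ⟨j, hj⟩ := Nat.exists_eq_add_of_le hle
      have hjm : j ≤ m := by omega
      have hjL : min (k * m) L + j ≤ L := by omega
      have hd := dist_path hv (min (k * m) L) j hjL
      rw [← hj] at hd
      rw [← dist_emb_sq] at hz ⊢
      have h1 : dist (emb z) (emb (v (min ((k + 1) * m) L))) ≤ r / 4 :=
        abs_le_of_sq_le_sq' (by linarith) (by linarith) |>.2
      have h2 := dist_triangle (emb z) (emb (v (min ((k + 1) * m) L))) (emb (v (min (k * m) L)))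
      rw [dist_comm] at hd
      have hjm' : (j : ℝ) ≤ m := by exact_mod_cast hjm
      have h3 : dist (emb z) (emb (v (min (k * m) L))) ≤ r / 2 := by linarith
      have h4 := dist_nonneg (x := emb z) (y := emb (v (min (k * m) L)))
      nlinarith

/-- For every `δ ∈ (0,1/100)` there is `C = C(δ) > 0` such that for all
`n ≥ 1`, all `x, y ∈ ∂B_n` and any arc `J` of the closed polygonal curve `∂B_n` with
endpoints `x, y` whose complementary part has diameter at least `10δn`, the Green's
function of simple random walk killed outside the `δn`-sausage of `J` satisfies
`G_{J^{δn}}(x,y) ≥ C`. -/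
theorem green_sausage_lower_bound :
    ∀ δ : ℝ, 0 < δ → δ < 1 / 100 →
    ∃ C : ℝ, 0 < C ∧
      ∀ (n : ℤ) (x y : Lat) (J : Set Plane),
        1 ≤ n → x ∈ bdry (box 0 n) → y ∈ bdry (box 0 n) → IsArc n x y J →
        10 * δ * (n : ℝ) ≤ Metric.diam (sqCurve n \ J) →
        ENNReal.ofReal C ≤ green (emb ⁻¹' Metric.cthickening (δ * (n : ℝ)) J) x y := by
  intro δ hδ _
  set K : ℕ := ⌈96 / δ⌉₊ with hK
  set N : ℕ := ⌈72 / δ⌉₊ with hN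
  have hKr : 96 / δ ≤ K := Nat.le_ceil _
  have hNr : 72 / δ ≤ N := Nat.le_ceil _
  have hkp := kap_pos
  refine ⟨min (kap ^ K * (1 / 2)) ((4 : ℝ)⁻¹ ^ N), by positivity, ?_⟩
  intro n x y J hn _ _ hJ _
  obtain ⟨-, hJc, hJs, hx, hy, -⟩ := hJ
  obtain ⟨L, v, hL, hv0, hvL, hvJ, hvA⟩ := exists_lattice_path hn hJc.isPreconnected hJs hx hy
  have hn1 : (1 : ℝ) ≤ n := by exact_mod_cast hn
  have hLr : (L : ℝ) ≤ 12 * n := by exact_mod_cast hL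
  set r : ℝ := δ * n with hr
  have hr0 : 0 < r := by positivity
  set D : Set Lat := emb ⁻¹' Metric.cthickening r J with hD
  have hDv : ∀ i z, sqd (v i) z < r ^ 2 → z ∈ D := by
    intro i z hz
    refine Metric.mem_cthickening_of_dist_le (emb z) (emb (v i)) r J (hvJ i) ?_
    rw [← dist_emb_sq] at hz
    exact (abs_le_of_sq_le_sq' hz.le hr0.le).2
  rw [← hv0, ← hvL]
  by_cases h6 : 6 ≤ r
  · refine le_trans (ENNReal.ofReal_le_ofReal (min_le_left _ _)) ?_
    set m : ℕ := ⌊r / 4⌋₊ with hm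
    have hm1 : (m : ℝ) ≤ r / 4 := Nat.floor_le (by positivity)
    have hm2 : r / 4 < m + 1 := Nat.lt_floor_add_one _
    have hm3 : r / 8 ≤ m := by
      have : 1 ≤ m := Nat.le_floor (by push_cast; linarith)
      have : (1 : ℝ) ≤ m := by exact_mod_cast this
      linarith
    have hKm : L ≤ K * m := by
      have h1 : 96 / δ * (r / 8) ≤ K * m := by gcongr
      have h2 : 96 / δ * (r / 8) = 12 * n := by rw [hr]; field_simp; norm_num
      have : (L : ℝ) ≤ K * m := by linarith
      exact_mod_cast this
    refine green_chain D v L m r h6 hm1 hDv hvA K (v L) ?_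
    rw [min_eq_right hKm]
    simp only [sqd, sub_self]
    have : 0 < r ^ 2 := by positivity
    linarith
  · refine le_trans (ENNReal.ofReal_le_ofReal (min_le_right _ _)) ?_
    refine le_trans ?_ (green_small D v L (fun i => hDv i _ ?_) hvA L le_rfl)
    · have hLN : L ≤ N := by
        have : (n : ℝ) ≤ 6 / δ := by
          rw [le_div_iff₀ hδ]; linarith
        have h2 : 12 * (6 / δ) = 72 / δ := by ring
        have : (L : ℝ) ≤ N := by linarith
        exact_mod_cast this
      have h1 : ENNReal.ofReal ((4 : ℝ)⁻¹ ^ N) = (4 : ℝ≥0∞)⁻¹ ^ N := by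
        rw [ENNReal.ofReal_pow (by positivity), ENNReal.ofReal_inv_of_pos (by norm_num)]
        norm_num
      rw [h1]
      exact pow_le_pow_of_le_one zero_le (by simp) hLN
    · simp only [sqd, sub_self]
      have : 0 < r ^ 2 := by positivity
      linarith

end RWLSPaper
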